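/- Let A ∈ ℝ^{n×n}, B ∈ ℝ^{n×m}, C ∈ ℝ^{q×n}. Suppose (A,C) is detectable in the PBH sense (for all λ ∈ ℂ with Re λ ≥ 0 and all nonzero v ∈ ℂ^n, A·v = λ·v implies C·v ≠ 0), and suppose there exist K ∈ ℝ^{m×q}, s ∈ ℂ, and a positive semidefinite Hermitian matrix P ∈ ℂ^{n×n} such that (A − s·B·K·C)*·P + P·(A − s·B·K·C) + Cᵀ·C + Cᵀ·Kᵀ·K·C = 0. Then the complex matrix A − s·B·K·C is Hurwitz. -/

import Mathlib

open Matrix Filter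
open scoped Kronecker ComplexOrder

noncomputable section

/-- The complexification of a real matrix, taken entrywise. -/
def cplx {a b : Type*} (M : Matrix a b ℝ) : Matrix a b ℂ := M.map (algebraMap ℝ ℂ)

/-- A square complex matrix is Hurwitz if every eigenvalue has negative real part. -/
def IsHurwitz {n : Type*} [Fintype n] [DecidableEq n] (M : Matrix n n ℂ) : Prop :=
  ∀ μ ∈ spectrum ℂ M, μ.re < 0

/-- An eigenvector of `M` for an eigenvalue in the closed right half-plane lies in the kernel of the
output matrix appearing in a Lyapunov equation with positive semidefinite solution. -/
theorem mulVec_eq_zero_of_lyapunov {n q : Type*} [Fintype n] [Fintype q]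
    {M P R : Matrix n n ℂ} {C : Matrix q n ℂ} (hP : P.PosSemidef) (hR : R.PosSemidef)
    (h : Mᴴ * P + P * M + (Cᴴ * C + R) = 0) {μ : ℂ} (hμ : 0 ≤ μ.re) {v : n → ℂ}
    (hv : M *ᵥ v = μ • v) : C *ᵥ v = 0 := by
  have key : (star μ + μ) * (star v ⬝ᵥ P *ᵥ v) + (star (C *ᵥ v) ⬝ᵥ C *ᵥ v + star v ⬝ᵥ R *ᵥ v)
      = 0 := by
    have h₁ : star v ⬝ᵥ (Mᴴ * P) *ᵥ v = star μ * (star v ⬝ᵥ P *ᵥ v) := by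
      rw [← mulVec_mulVec, dotProduct_mulVec, ← star_mulVec, hv, star_smul, smul_dotProduct,
        smul_eq_mul]
    have h₂ : star v ⬝ᵥ (P * M) *ᵥ v = μ * (star v ⬝ᵥ P *ᵥ v) := by
      rw [← mulVec_mulVec, hv, mulVec_smul, dotProduct_smul, smul_eq_mul]
    have h₃ : star v ⬝ᵥ (Cᴴ * C) *ᵥ v = star (C *ᵥ v) ⬝ᵥ C *ᵥ v := by
      rw [← mulVec_mulVec, dotProduct_mulVec, ← star_mulVec]
    have h₀ := congrArg (fun X : Matrix n n ℂ => star v ⬝ᵥ X *ᵥ v) h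
    simp only [add_mulVec, dotProduct_add, zero_mulVec, dotProduct_zero, h₁, h₂, h₃] at h₀
    rw [add_mul, h₀]
  have hμ' : 0 ≤ star μ + μ := by
    rw [Complex.le_def]
    simpa using add_nonneg hμ hμ
  have hp := mul_nonneg hμ' (hP.dotProduct_mulVec_nonneg v)
  have hc := dotProduct_star_self_nonneg (C *ᵥ v)
  have hr := hR.dotProduct_mulVec_nonneg v
  have hcr := (add_eq_zero_iff_of_nonneg hp (add_nonneg hc hr)).1 key
  exact dotProduct_star_self_eq_zero.1 ((add_eq_zero_iff_of_nonneg hc hr).1 hcr.2).1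

theorem cplx_add {a b : Type*} (M N : Matrix a b ℝ) : cplx (M + N) = cplx M + cplx N :=
  Matrix.map_add _ (map_add _) M N

theorem cplx_mul {a b c : Type*} [Fintype b] (M : Matrix a b ℝ) (N : Matrix b c ℝ) :
    cplx (M * N) = cplx M * cplx N :=
  Matrix.map_mul

theorem cplx_transpose {a b : Type*} (M : Matrix a b ℝ) : cplx Mᵀ = (cplx M)ᴴ := by
  ext i j
  simp [cplx]

theorem hurwitz_of_detectable_and_psd_lyapunov
    {n m q : ℕ} (A : Matrix (Fin n) (Fin n) ℝ) (B : Matrix (Fin n) (Fin m) ℝ)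
    (C : Matrix (Fin q) (Fin n) ℝ)
    (hdet : ∀ (μ : ℂ) (v : Fin n → ℂ), 0 ≤ μ.re → v ≠ 0 →
      (cplx A) *ᵥ v = μ • v → (cplx C) *ᵥ v ≠ 0)
    (K : Matrix (Fin m) (Fin q) ℝ) (s : ℂ) (P : Matrix (Fin n) (Fin n) ℂ)
    (hP : P.PosSemidef)
    (heq : (cplx A - s • (cplx B * cplx K * cplx C))ᴴ * P
        + P * (cplx A - s • (cplx B * cplx K * cplx C))
        + cplx (Cᵀ * C + Cᵀ * Kᵀ * K * C) = 0) :
    IsHurwitz (cplx A - s • (cplx B * cplx K * cplx C)) := by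
  intro μ hμ
  by_contra! hre
  rw [← spectrum_toLin', ← Module.End.hasEigenvalue_iff_mem_spectrum] at hμ
  obtain ⟨v, hv⟩ := hμ.exists_hasEigenvector
  have hMv := hv.apply_eq_smul
  rw [toLin'_apply] at hMv
  have hQ : cplx (Cᵀ * C + Cᵀ * Kᵀ * K * C)
      = (cplx C)ᴴ * cplx C + (cplx K * cplx C)ᴴ * (cplx K * cplx C) := by
    simp only [cplx_add, cplx_mul, cplx_transpose, conjTranspose_mul, Matrix.mul_assoc]
  rw [hQ] at heq
  have hCv : cplx C *ᵥ v = 0 :=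
    mulVec_eq_zero_of_lyapunov hP (posSemidef_conjTranspose_mul_self _) heq hre hMv
  refine hdet μ v hre hv.2 ?_ hCv
  rw [sub_mulVec, smul_mulVec, ← mulVec_mulVec, hCv] at hMv
  simpa using hMv
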